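/- arXiv:1109.2315 — 8 statements merged into one kernel-verified Lean document; each statement's English description precedes it below -/
import Mathlib

section
/- Let f : N_1 → N_0 be a ℂ[[ħ]]-linear map of ℂ[[ħ]]-modules, where N_1 is ħ-adically complete and separated, and N_0 is ħ-adically separated and flat over ℂ[[ħ]]. Assume that the induced map f̄ : N_1/ħN_1 → N_0/ħN_0 is surjective. Then the canonical map ker(f)/ħ·ker(f) → ker(f̄), induced by reduction modulo ħ, is an isomorphism of ℂ-vector spaces. -/
/-- The ideal `(ħ) ⊆ ℂ[[ħ]]`, where `ħ` is the power series variable `X`. -/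
noncomputable def hbarIdeal : Ideal (PowerSeries ℂ) := Ideal.span {PowerSeries.X}

/-- The submodule `ħM ⊆ M`. -/
noncomputable def hbarSub (M : Type*) [AddCommGroup M] [Module (PowerSeries ℂ) M] :
    Submodule (PowerSeries ℂ) M := hbarIdeal • ⊤

/-- The induced map `f̄ : M/ħM → N/ħN` of a `ℂ[[ħ]]`-linear map `f : M → N`. -/
noncomputable def reduceModHbar {M N : Type*} [AddCommGroup M] [Module (PowerSeries ℂ) M]
    [AddCommGroup N] [Module (PowerSeries ℂ) N] (f : M →ₗ[PowerSeries ℂ] N) :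
    (M ⧸ hbarSub M) →ₗ[PowerSeries ℂ] N ⧸ hbarSub N :=
  Submodule.mapQ (hbarSub M) (hbarSub N) f (by
    rw [← Submodule.map_le_iff_le_comap]
    simp only [hbarSub]
    rw [Submodule.map_smul'']
    exact Submodule.smul_mono le_rfl le_top)

/-- The map `ker f → ker f̄` sending an element of the kernel to its class mod `ħ`. -/
noncomputable def kerToKerBar {M N : Type*} [AddCommGroup M] [Module (PowerSeries ℂ) M]
    [AddCommGroup N] [Module (PowerSeries ℂ) N] (f : M →ₗ[PowerSeries ℂ] N) :
    ↥(LinearMap.ker f) →ₗ[PowerSeries ℂ] ↥(LinearMap.ker (reduceModHbar f)) :=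
  LinearMap.codRestrict _ ((hbarSub M).mkQ ∘ₗ (LinearMap.ker f).subtype) (fun x => by
    have hx : f x.1 = 0 := x.2
    simp only [LinearMap.mem_ker, LinearMap.comp_apply, Submodule.subtype_apply,
      Submodule.mkQ_apply, reduceModHbar, Submodule.mapQ_apply, hx,
      Submodule.Quotient.mk_zero])

/-- The canonical map `(ker f)/ħ·(ker f) → ker f̄` induced by reduction modulo `ħ`. -/
noncomputable def kerModHbarToKerBar {M N : Type*} [AddCommGroup M]
    [Module (PowerSeries ℂ) M] [AddCommGroup N] [Module (PowerSeries ℂ) N]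
    (f : M →ₗ[PowerSeries ℂ] N) :
    (↥(LinearMap.ker f) ⧸ hbarSub ↥(LinearMap.ker f)) →ₗ[PowerSeries ℂ]
      ↥(LinearMap.ker (reduceModHbar f)) :=
  Submodule.liftQ _ (kerToKerBar f) (by
    intro x hx
    have h1 : (x : M) ∈ hbarSub M := by
      have h2 := Submodule.mem_map_of_mem (f := (LinearMap.ker f).subtype) hx
      simp only [hbarSub] at h2 ⊢
      rw [Submodule.map_smul'', Submodule.map_subtype_top] at h2
      exact Submodule.smul_mono le_rfl le_top h2
    rw [LinearMap.mem_ker]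
    apply Subtype.ext
    simp only [kerToKerBar, LinearMap.codRestrict_apply, LinearMap.comp_apply,
      Submodule.subtype_apply, Submodule.mkQ_apply, ZeroMemClass.coe_zero]
    exact (Submodule.Quotient.mk_eq_zero _).2 h1)

theorem mem_hbarSub_iff {M : Type*} [AddCommGroup M] [Module (PowerSeries ℂ) M] {x : M} :
    x ∈ hbarSub M ↔ ∃ y : M, (PowerSeries.X : PowerSeries ℂ) • y = x := by
  rw [hbarSub, hbarIdeal, Submodule.ideal_span_singleton_smul,
    Submodule.mem_smul_pointwise_iff_exists]
  simp

theorem kerModHbarToKerBar_injective {M N : Type*} [AddCommGroup M] [Module (PowerSeries ℂ) M]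
    [AddCommGroup N] [Module (PowerSeries ℂ) N] [Module.Flat (PowerSeries ℂ) N]
    (f : M →ₗ[PowerSeries ℂ] N) : Function.Injective (kerModHbarToKerBar f) := by
  rw [← LinearMap.ker_eq_bot, LinearMap.ker_eq_bot']
  intro q hq
  obtain ⟨x, rfl⟩ := Submodule.Quotient.mk_surjective _ q
  have hx : (x : M) ∈ hbarSub M := (Submodule.Quotient.mk_eq_zero _).1 (congrArg Subtype.val hq)
  obtain ⟨z, hz⟩ := mem_hbarSub_iff.1 hx
  have hfz : (PowerSeries.X : PowerSeries ℂ) • f z = 0 := by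
    rw [← map_smul, hz]
    exact x.2
  have hz0 : f z = 0 := (smul_eq_zero.1 hfz).resolve_left PowerSeries.X_ne_zero
  exact (Submodule.Quotient.mk_eq_zero _).2 (mem_hbarSub_iff.2 ⟨⟨z, hz0⟩, Subtype.ext hz⟩)

theorem kerModHbarToKerBar_surjective {M N : Type*} [AddCommGroup M] [Module (PowerSeries ℂ) M]
    [AddCommGroup N] [Module (PowerSeries ℂ) N] {f : M →ₗ[PowerSeries ℂ] N}
    (hf : Function.Surjective f) : Function.Surjective (kerModHbarToKerBar f) := by
  rintro ⟨q, hq⟩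
  obtain ⟨x, rfl⟩ := Submodule.Quotient.mk_surjective _ q
  have hx : f x ∈ hbarSub N := (Submodule.Quotient.mk_eq_zero _).1 hq
  obtain ⟨y, hy⟩ := mem_hbarSub_iff.1 hx
  obtain ⟨z, rfl⟩ := hf y
  refine ⟨Submodule.Quotient.mk ⟨x - (PowerSeries.X : PowerSeries ℂ) • z, ?_⟩, Subtype.ext ?_⟩
  · rw [LinearMap.mem_ker, map_sub, map_smul, hy, sub_self]
  · refine (Submodule.Quotient.eq _).2 (mem_hbarSub_iff.2 ⟨-z, ?_⟩)
    simp

/-- for a `ℂ[[ħ]]`-linear map `f : N₁ → N₀` with `N₁` `ħ`-adically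
complete and separated, `N₀` `ħ`-adically separated and flat over `ℂ[[ħ]]`, and
`f̄ : N₁/ħN₁ → N₀/ħN₀` surjective, the canonical map
`(ker f)/ħ·(ker f) → ker f̄` is an isomorphism (of `ℂ`-vector spaces). -/
theorem statement1 {N₁ N₀ : Type*} [AddCommGroup N₁] [Module (PowerSeries ℂ) N₁]
    [AddCommGroup N₀] [Module (PowerSeries ℂ) N₀]
    [IsAdicComplete hbarIdeal N₁] [IsHausdorff hbarIdeal N₀]
    [Module.Flat (PowerSeries ℂ) N₀]
    (f : N₁ →ₗ[PowerSeries ℂ] N₀)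
    (hsurj : Function.Surjective (reduceModHbar f)) :
    Function.Bijective (kerModHbarToKerBar f) := by
  refine ⟨kerModHbarToKerBar_injective f, kerModHbarToKerBar_surjective ?_⟩
  refine surjective_of_mkQ_comp_surjective (I := hbarIdeal) ?_
  exact hsurj.comp (Submodule.mkQ_surjective (hbarSub N₁))
end

section
/- Let E be an associative unital ℂ[[ħ]]-algebra (not necessarily commutative) that is ħ-adically complete as a ℂ[[ħ]]-module. Let d : C' → C be a homomorphism of left E-modules, where C' and C are ħ-adically complete and separated, and let Z ⊆ C be an E-submodule with d(C') ⊆ Z. If the E-module Z/(d(C') + ħZ) is finitely generated, then the E-module Z/d(C') is finitely generated. -/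
open Pointwise

theorem mem_hbarIdeal_pow_smul_top_iff {M : Type*} [AddCommGroup M] [Module (PowerSeries ℂ) M]
    (n : ℕ) (x : M) :
    x ∈ (hbarIdeal ^ n • ⊤ : Submodule (PowerSeries ℂ) M) ↔
      ∃ y : M, (PowerSeries.X : PowerSeries ℂ) ^ n • y = x := by
  rw [hbarIdeal, Ideal.span_singleton_pow, Submodule.ideal_span_singleton_smul,
    Submodule.mem_smul_pointwise_iff_exists]
  simp

/-- In an `ħ`-adically complete module every power series in `ħ` has a sum. -/
theorem exists_hbar_series_sum {M : Type*} [AddCommGroup M] [Module (PowerSeries ℂ) M]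
    [IsPrecomplete hbarIdeal M] (a : ℕ → M) :
    ∃ L : M, ∀ n, ∃ y : M,
      L = ∑ k ∈ Finset.range n, (PowerSeries.X : PowerSeries ℂ) ^ k • a k +
        (PowerSeries.X : PowerSeries ℂ) ^ n • y := by
  obtain ⟨L, hL⟩ := IsPrecomplete.prec' (I := hbarIdeal)
    (fun n => ∑ k ∈ Finset.range n, (PowerSeries.X : PowerSeries ℂ) ^ k • a k) (by
      intro m n hmn
      rw [SModEq.comm, SModEq.sub_mem, ← Finset.sum_Ico_eq_sub _ hmn]
      refine Submodule.sum_mem _ fun k hk => ?_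
      rw [mem_hbarIdeal_pow_smul_top_iff]
      refine ⟨(PowerSeries.X : PowerSeries ℂ) ^ (k - m) • a k, ?_⟩
      rw [smul_smul, ← pow_add, Nat.add_sub_cancel' (Finset.mem_Ico.mp hk).1])
  refine ⟨L, fun n => ?_⟩
  have h := (hL n).symm
  rw [SModEq.sub_mem, mem_hbarIdeal_pow_smul_top_iff] at h
  obtain ⟨y, hy⟩ := h
  exact ⟨y, by rw [hy]; abel⟩

/-- An element divisible by every power of `ħ` in a separated module vanishes. -/
theorem eq_zero_of_forall_hbar_pow_smul {M : Type*} [AddCommGroup M] [Module (PowerSeries ℂ) M]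
    [IsHausdorff hbarIdeal M] (x : M)
    (h : ∀ n : ℕ, ∃ y : M, x = (PowerSeries.X : PowerSeries ℂ) ^ n • y) : x = 0 := by
  refine IsHausdorff.haus' (I := hbarIdeal) x fun n => ?_
  rw [SModEq.zero, mem_hbarIdeal_pow_smul_top_iff]
  obtain ⟨y, hy⟩ := h n
  exact ⟨y, hy.symm⟩

/-- The `E`-span of `ħZ` consists of the elements `ħz` with `z ∈ Z`. -/
theorem exists_of_mem_span_hbar_smul {E C : Type*} [Ring E] [Algebra (PowerSeries ℂ) E]
    [AddCommGroup C] [Module E C] [Module (PowerSeries ℂ) C]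
    [IsScalarTower (PowerSeries ℂ) E C] (Z : Submodule E C) {x : C}
    (hx : x ∈ Submodule.span E ((PowerSeries.X : PowerSeries ℂ) • (Z : Set C))) :
    ∃ z : Z, (PowerSeries.X : PowerSeries ℂ) • (z : C) = x := by
  induction hx using Submodule.span_induction with
  | mem x hx =>
    obtain ⟨z, hz, rfl⟩ := hx
    exact ⟨⟨z, hz⟩, rfl⟩
  | zero => exact ⟨0, by simp⟩
  | add x y _ _ hx hy =>
    obtain ⟨z, rfl⟩ := hx
    obtain ⟨w, rfl⟩ := hy
    exact ⟨z + w, by simp⟩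
  | smul e x _ hx =>
    obtain ⟨z, rfl⟩ := hx
    refine ⟨e • z, ?_⟩
    rw [← algebraMap_smul E (PowerSeries.X : PowerSeries ℂ) (z : C),
      ← algebraMap_smul E (PowerSeries.X : PowerSeries ℂ) ((e • z : Z) : C),
      Submodule.coe_smul, smul_smul, smul_smul, Algebra.commutes]

/-- Successive approximation: if `T` is a linear map from a complete module to a separated one
and every element of `Z` is in the image of `T` modulo `ħZ`, then `Z` is in the image of `T`. -/
theorem exists_eq_of_forall_exists_eq_add_hbar_smul {M C : Type*}
    [AddCommGroup M] [Module (PowerSeries ℂ) M] [AddCommGroup C] [Module (PowerSeries ℂ) C]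
    [IsHausdorff hbarIdeal C] (T : M →ₗ[PowerSeries ℂ] C)
    (hM : ∀ a : ℕ → M, ∃ L : M, ∀ n, ∃ y : M,
      L = ∑ k ∈ Finset.range n, (PowerSeries.X : PowerSeries ℂ) ^ k • a k +
        (PowerSeries.X : PowerSeries ℂ) ^ n • y)
    (Z : Set C)
    (h : ∀ z : Z, ∃ (m : M) (w : Z), (z : C) = T m + (PowerSeries.X : PowerSeries ℂ) • (w : C))
    (z : Z) : ∃ m : M, (z : C) = T m := by
  choose a w haw using h
  obtain ⟨L, hL⟩ := hM fun k => a (w^[k] z)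
  have key (n : ℕ) : (z : C) =
      T (∑ k ∈ Finset.range n, (PowerSeries.X : PowerSeries ℂ) ^ k • a (w^[k] z)) +
        (PowerSeries.X : PowerSeries ℂ) ^ n • (w^[n] z : C) := by
    induction n with
    | zero => simp
    | succ n ih =>
      rw [Finset.sum_range_succ, map_add, map_smul, Function.iterate_succ_apply', pow_succ,
        mul_smul, add_assoc, ← smul_add, ← haw]
      exact ih
  refine ⟨L, sub_eq_zero.mp (eq_zero_of_forall_hbar_pow_smul _ fun n => ?_)⟩
  obtain ⟨y, hy⟩ := hL n
  refine ⟨(w^[n] z : C) - T y, ?_⟩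
  rw [hy, map_add, map_smul, smul_sub]
  nth_rewrite 1 [key n]
  abel

/-- let `E` be an associative unital `ℂ[[ħ]]`-algebra that is `ħ`-adically
complete, `d : C' → C` a homomorphism of left `E`-modules with `C'`, `C` `ħ`-adically
complete and separated, and `Z ⊆ C` an `E`-submodule containing `d(C')`.  If
`Z/(d(C') + ħZ)` is a finitely generated `E`-module then so is `Z/d(C')`. -/
theorem statement4
    (E : Type*) [Ring E] [Algebra (PowerSeries ℂ) E]
    [IsPrecomplete hbarIdeal E]
    (C' C : Type*)
    [AddCommGroup C'] [Module E C'] [Module (PowerSeries ℂ) C']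
    [IsScalarTower (PowerSeries ℂ) E C'] [IsAdicComplete hbarIdeal C']
    [AddCommGroup C] [Module E C] [Module (PowerSeries ℂ) C]
    [IsScalarTower (PowerSeries ℂ) E C] [IsAdicComplete hbarIdeal C]
    (d : C' →ₗ[E] C) (Z : Submodule E C) (hZ : LinearMap.range d ≤ Z)
    (hfg : Module.Finite E
      (↥Z ⧸ Submodule.comap Z.subtype
        (LinearMap.range d ⊔
          Submodule.span E ((PowerSeries.X : PowerSeries ℂ) • (Z : Set C))))) :
    Module.Finite E (↥Z ⧸ Submodule.comap Z.subtype (LinearMap.range d)) := by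
  obtain ⟨n, s, hs⟩ := Module.Finite.exists_fin (R := E) (M := ↥Z ⧸ Submodule.comap Z.subtype
    (LinearMap.range d ⊔ Submodule.span E ((PowerSeries.X : PowerSeries ℂ) • (Z : Set C))))
  choose g hg using fun i => Submodule.mkQ_surjective _ (s i)
  let T : ((Fin n → E) × C') →ₗ[E] C :=
    (Fintype.linearCombination E fun i => (g i : C)).coprod d
  have hT (e : Fin n → E) (c : C') : T (e, c) = ∑ i, e i • (g i : C) + d c := by
    simp [T, Fintype.linearCombination_apply]
  have hseries (a : ℕ → (Fin n → E) × C') : ∃ L : (Fin n → E) × C', ∀ N, ∃ y,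
      L = ∑ k ∈ Finset.range N, (PowerSeries.X : PowerSeries ℂ) ^ k • a k +
        (PowerSeries.X : PowerSeries ℂ) ^ N • y := by
    choose e y hy using fun i => exists_hbar_series_sum fun k => (a k).1 i
    obtain ⟨c, hc⟩ := exists_hbar_series_sum fun k => (a k).2
    choose y' hy' using hc
    refine ⟨(e, c), fun N => ⟨(fun i => y i N, y' N), Prod.ext (funext fun i => ?_) ?_⟩⟩
    · simpa [Prod.fst_sum] using hy i N
    · simpa [Prod.snd_sum] using hy' N
  have hstep (z : (Z : Set C)) : ∃ (m : (Fin n → E) × C') (w : (Z : Set C)),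
      (z : C) = T m + (PowerSeries.X : PowerSeries ℂ) • (w : C) := by
    have hz : Submodule.Quotient.mk (p := Submodule.comap Z.subtype (LinearMap.range d ⊔
        Submodule.span E ((PowerSeries.X : PowerSeries ℂ) • (Z : Set C)))) (⟨z, z.2⟩ : Z) ∈
        Submodule.span E (Set.range s) := hs ▸ Submodule.mem_top
    obtain ⟨e, he⟩ := (Submodule.mem_span_range_iff_exists_fun E).mp hz
    simp only [← hg, ← map_smul, ← map_sum] at he
    have hmem := (Submodule.Quotient.eq _).mp he.symm
    obtain ⟨_, ⟨c, rfl⟩, x, hx, hcx⟩ := Submodule.mem_sup.mp (Submodule.mem_comap.mp hmem)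
    obtain ⟨w, rfl⟩ := exists_of_mem_span_hbar_smul Z hx
    refine ⟨(e, c), w, ?_⟩
    rw [hT, add_assoc, hcx]
    simp
  refine Module.Finite.of_surjective (Fintype.linearCombination E fun i =>
    (Submodule.comap Z.subtype (LinearMap.range d)).mkQ (g i)) fun q => ?_
  obtain ⟨z, rfl⟩ := Submodule.mkQ_surjective _ q
  obtain ⟨⟨e, c⟩, hec⟩ := exists_eq_of_forall_exists_eq_add_hbar_smul
    (T.restrictScalars (PowerSeries ℂ)) hseries Z hstep z
  refine ⟨e, ?_⟩
  rw [LinearMap.restrictScalars_apply, hT] at hec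
  simp only [Fintype.linearCombination_apply, ← map_smul, ← map_sum]
  refine ((Submodule.Quotient.eq _).mpr ?_).symm
  refine Submodule.mem_comap.mpr ⟨c, ?_⟩
  simp [hec]
end

section
/- Let A be a commutative ℂ-algebra that is finitely generated as a ℂ-algebra and is equipped with a ℤ-grading A = ⨁_{i∈ℤ} A_i. Then A_{≤0} := ⨁_{i≤0} A_i is a ℂ-subalgebra of A that is finitely generated as a ℂ-algebra; in particular, A_{≤0} is a Noetherian ring. -/
namespace GradedAlgebra

variable {R A : Type*} [CommRing R] [CommRing A] [Algebra R A]
  (𝒜 : ℤ → Submodule R A) [GradedAlgebra 𝒜]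

/-- The subalgebra of elements whose components of positive degree vanish. -/
def nonposSubalgebra : Subalgebra R A where
  carrier := {a | ∀ i : ℤ, 0 < i → DirectSum.decompose 𝒜 a i = 0}
  algebraMap_mem' r i hi := by
    ext
    exact DirectSum.decompose_of_mem_ne 𝒜 (SetLike.algebraMap_mem_graded 𝒜 r) hi.ne
  add_mem' ha hb i hi := by simp [ha i hi, hb i hi]
  mul_mem' {a b} ha hb i hi := by
    classical
    ext
    change GradedAlgebra.proj 𝒜 i (a * b) = 0
    rw [← DirectSum.sum_support_decompose 𝒜 a, ← DirectSum.sum_support_decompose 𝒜 b,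
      Finset.sum_mul_sum]
    simp only [map_sum]
    refine Finset.sum_eq_zero fun j hj ↦ Finset.sum_eq_zero fun k hk ↦ ?_
    have hj : j ≤ 0 := not_lt.1 fun h ↦ DFinsupp.mem_support_iff.1 hj (ha j h)
    have hk : k ≤ 0 := not_lt.1 fun h ↦ DFinsupp.mem_support_iff.1 hk (hb k h)
    exact DirectSum.decompose_of_mem_ne 𝒜
      (SetLike.mul_mem_graded (SetLike.coe_mem _) (SetLike.coe_mem _)) (by omega)

theorem mem_nonposSubalgebra_of_mem {a : A} {n : ℤ} (ha : a ∈ 𝒜 n) (hn : n ≤ 0) :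
    a ∈ nonposSubalgebra 𝒜 := fun i hi ↦ by
  ext
  exact DirectSum.decompose_of_mem_ne 𝒜 ha (by omega)

theorem exists_finset_adjoin_base_eq_top_and_homogeneous [Algebra.FiniteType R A] :
    ∃ s : Finset A, Algebra.adjoin R (s : Set A) = ⊤ ∧
      ∀ a ∈ s, SetLike.IsHomogeneousElem 𝒜 a := by
  classical
  obtain ⟨F, hF⟩ := Algebra.FiniteType.out (R := R) (A := A)
  refine ⟨F.biUnion fun a ↦ (DirectSum.decompose 𝒜 a).support.image
    fun i ↦ (DirectSum.decompose 𝒜 a i : A), ?_, ?_⟩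
  · rw [← top_le_iff, ← hF, Algebra.adjoin_le_iff]
    intro a ha
    rw [← DirectSum.sum_support_decompose 𝒜 a]
    refine sum_mem fun i hi ↦ Algebra.subset_adjoin ?_
    exact Finset.mem_biUnion.2 ⟨a, ha, Finset.mem_image_of_mem _ hi⟩
  · intro b hb
    obtain ⟨a, -, hb⟩ := Finset.mem_biUnion.1 hb
    obtain ⟨i, -, rfl⟩ := Finset.mem_image.1 hb
    exact ⟨i, SetLike.coe_mem _⟩

end GradedAlgebra

/-- The submonoid of `ℕ ^ ι` cut out by a linear inequality is finitely generated, a version of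
**Gordan's lemma**. -/
theorem AddSubmonoid.fg_comap_nonpos {ι : Type*} [Finite ι] (f : (ι → ℕ) →+ ℤ) :
    ((AddSubmonoid.nonneg ℤ).comap (-f)).FG := by
  let g : (ι → ℕ) × ℕ →+ ℤ := f.coprod (Nat.castAddMonoidHom ℤ)
  have hg : ((AddSubmonoid.nonneg ℤ).comap (-f)) =
      (g.eqLocusM 0).map (AddMonoidHom.fst (ι → ℕ) ℕ) := by
    ext m
    simp only [AddSubmonoid.mem_comap, AddSubmonoid.mem_nonneg, AddSubmonoid.mem_map]
    constructor
    · intro h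
      refine ⟨(m, (-f m).toNat), ?_, rfl⟩
      change f m + (((-f m).toNat : ℕ) : ℤ) = 0
      change 0 ≤ -f m at h
      omega
    · rintro ⟨⟨m, k⟩, h, rfl⟩
      change f m + (k : ℤ) = 0 at h
      change 0 ≤ -f m
      omega
  rw [hg]
  exact (AddSubmonoid.fg_eqLocusM g 0).map _

namespace GradedAlgebra

variable {R A : Type*} [CommRing R] [CommRing A] [Algebra R A]
  (𝒜 : ℤ → Submodule R A) [GradedAlgebra 𝒜]

theorem fg_nonposSubalgebra [Algebra.FiniteType R A] : (nonposSubalgebra 𝒜).FG := by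
  classical
  obtain ⟨s, hs, hom⟩ := exists_finset_adjoin_base_eq_top_and_homogeneous 𝒜
  choose d hd using fun a : s ↦ hom a a.2
  let deg : (s → ℕ) →+ ℤ :=
    { toFun m := ∑ a : s, m a • d a
      map_zero' := by simp
      map_add' m n := by simp [add_mul, Finset.sum_add_distrib] }
  let mon (m : s → ℕ) : A := ∏ a : s, (a : A) ^ m a
  have mon_add (m n) : mon (m + n) = mon m * mon n := by
    simp [mon, pow_add, Finset.prod_mul_distrib]
  have mon_mem (m) : mon m ∈ 𝒜 (deg m) :=
    SetLike.prod_mem_graded _ _ _ fun a _ ↦ SetLike.pow_mem_graded _ (hd a)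
  obtain ⟨T, hT⟩ := AddSubmonoid.fg_comap_nonpos deg
  have mon_mem_adjoin (m) (hm : deg m ≤ 0) : mon m ∈ Algebra.adjoin R (Set.image mon T) := by
    have hmT : m ∈ AddSubmonoid.closure (T : Set (s → ℕ)) := by
      rw [hT]
      exact neg_nonneg.2 hm
    clear hm
    induction hmT using AddSubmonoid.closure_induction with
    | mem m hm => exact Algebra.subset_adjoin ⟨m, hm, rfl⟩
    | zero => simp [mon]
    | add m n _ _ hm hn => exact mon_add m n ▸ mul_mem hm hn
  refine ⟨T.image mon, le_antisymm ?_ fun a ha ↦ ?_⟩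
  · rw [Finset.coe_image, Algebra.adjoin_le_iff]
    rintro _ ⟨m, hm, rfl⟩
    have : m ∈ (AddSubmonoid.nonneg ℤ).comap (-deg) := hT ▸ AddSubmonoid.subset_closure hm
    exact mem_nonposSubalgebra_of_mem 𝒜 (mon_mem m) (neg_nonneg.1 this)
  · rw [Finset.coe_image]
    have key (i : ℤ) (hi : i ≤ 0) (b : A) :
        (DirectSum.decompose 𝒜 b i : A) ∈ Algebra.adjoin R (Set.image mon T) := by
      have hb : b ∈ Algebra.adjoin R (Set.range ((↑) : s → A)) := by
        simp [hs]
      rw [Algebra.adjoin_range_eq_range_aeval] at hb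
      obtain ⟨p, rfl⟩ := hb
      induction p using MvPolynomial.induction_on' with
      | add p q hp hq => simpa using add_mem hp hq
      | monomial m r =>
        have hm : MvPolynomial.aeval ((↑) : s → A) (MvPolynomial.monomial m r) = r • mon m := by
          rw [MvPolynomial.aeval_monomial, Finsupp.prod_fintype _ _ (by simp), Algebra.smul_def]
        change (DirectSum.decompose 𝒜 (MvPolynomial.aeval _ _) i : A) ∈ _
        rw [hm]
        obtain rfl | hne := eq_or_ne (deg m) i
        · rw [DirectSum.decompose_of_mem_same 𝒜 (Submodule.smul_mem _ _ (mon_mem m))]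
          exact Subalgebra.smul_mem _ (mon_mem_adjoin m hi) r
        · rw [DirectSum.decompose_of_mem_ne 𝒜 (Submodule.smul_mem _ _ (mon_mem m)) hne]
          exact zero_mem _
    rw [← DirectSum.sum_support_decompose 𝒜 a]
    exact sum_mem fun i hi ↦ key i (not_lt.1 fun h ↦ DFinsupp.mem_support_iff.1 hi (ha i h)) a

end GradedAlgebra

/-- if `A` is a finitely generated commutative `ℂ`-algebra with a
`ℤ`-grading `A = ⨁ᵢ Aᵢ`, then `A_{≤0} = ⨁_{i ≤ 0} Aᵢ` (the set of elements whose
homogeneous components of strictly positive degree vanish) is a `ℂ`-subalgebra of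
`A` that is finitely generated as a `ℂ`-algebra; in particular it is Noetherian. -/
theorem statement5 (A : Type*) [CommRing A] [Algebra ℂ A]
    (𝒜 : ℤ → Submodule ℂ A) [GradedAlgebra 𝒜] [Algebra.FiniteType ℂ A] :
    ∃ B : Subalgebra ℂ A,
      (B : Set A) = {a : A | ∀ i : ℤ, 0 < i → (DirectSum.decompose 𝒜 a) i = 0} ∧
      B.FG ∧ IsNoetherianRing ↥B := by
  have hfg := GradedAlgebra.fg_nonposSubalgebra 𝒜
  have : Algebra.FiniteType ℂ (GradedAlgebra.nonposSubalgebra 𝒜) :=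
    (Subalgebra.fg_iff_finiteType _).1 hfg
  exact ⟨GradedAlgebra.nonposSubalgebra 𝒜, rfl, hfg, Algebra.FiniteType.isNoetherianRing ℂ _⟩
end

section
/- Let A be a commutative ℂ-algebra equipped with a ℤ-grading A = ⨁_{i∈ℤ} A_i. Suppose there exist homogeneous elements a_1,…,a_n of strictly positive degrees and b_1,…,b_m of strictly negative degrees such that A is finitely generated as a module over the ℂ-subalgebra of A generated by a_1,…,a_n,b_1,…,b_m. Let I ⊆ A be the ideal generated by all homogeneous elements of strictly negative degree. Then the quotient A_0/(A_0 ∩ I) is a finite-dimensional ℂ-vector space. -/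
/-- A monomial in elements of given degrees is homogeneous of the weighted degree. -/
lemma prod_pow_mem_graded {A : Type*} [CommRing A] [Algebra ℂ A]
    (𝒜 : ℤ → Submodule ℂ A) [GradedAlgebra 𝒜] {n : ℕ} (a : Fin n → A) (da : Fin n → ℤ)
    (ha : ∀ i, a i ∈ 𝒜 (da i)) (α : Fin n → ℕ) :
    ∏ i, a i ^ α i ∈ 𝒜 (∑ i, α i • da i) :=
  SetLike.prod_mem_graded _ _ _ fun i _ => SetLike.pow_mem_graded _ (ha i)

/-- Only finitely many exponents have a given weighted degree, for positive weights. -/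
lemma finite_setOf_weighted_sum_eq {n : ℕ} (da : Fin n → ℤ) (hda : ∀ i, 0 < da i) (d : ℤ) :
    {α : Fin n → ℕ | ∑ i, α i • da i = d}.Finite := by
  refine (Set.finite_Iic (fun _ : Fin n => d.toNat)).subset fun α hα i => ?_
  have h1 : α i • da i ≤ ∑ i, α i • da i :=
    Finset.single_le_sum (f := fun i => α i • da i)
      (fun j _ => nsmul_nonneg (hda j).le _) (Finset.mem_univ i)
  rw [hα, nsmul_eq_mul] at h1
  have h2 : (α i : ℤ) ≤ α i * da i := le_mul_of_one_le_right (by positivity) (hda i)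
  change α i ≤ d.toNat
  omega

/-- A linear map seeing only degree-zero components takes finitely many values on the products of
a fixed element with monomials in elements of positive degree. -/
lemma finite_range_monomial_mul {A : Type*} [CommRing A] [Algebra ℂ A]
    (𝒜 : ℤ → Submodule ℂ A) [GradedAlgebra 𝒜] {n : ℕ} (a : Fin n → A) (da : Fin n → ℤ)
    (hda : ∀ i, 0 < da i) (ha : ∀ i, a i ∈ 𝒜 (da i))
    {M : Type*} [AddCommGroup M] [Module ℂ M] (p : A →ₗ[ℂ] M)
    (hp : ∀ x, DirectSum.decompose 𝒜 x 0 = 0 → p x = 0) (s : A) :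
    (Set.range fun α : Fin n → ℕ => p ((∏ i, a i ^ α i) * s)).Finite := by
  classical
  have hfin : (⋃ d ∈ (DirectSum.decompose 𝒜 s).support,
      {α : Fin n → ℕ | ∑ i, α i • da i = -d}).Finite :=
    (Finset.finite_toSet _).biUnion fun d _ => finite_setOf_weighted_sum_eq da hda (-d)
  refine ((hfin.image fun α => p ((∏ i, a i ^ α i) * s)).insert 0).subset ?_
  rintro _ ⟨α, rfl⟩
  by_cases hα : DirectSum.decompose 𝒜 s (-∑ i, α i • da i) = 0
  · refine Or.inl (hp _ (Subtype.ext ?_))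
    have h := DirectSum.coe_decompose_mul_add_of_left_mem 𝒜 (j := -∑ i, α i • da i) (b := s)
      (prod_pow_mem_graded 𝒜 a da ha α)
    rw [add_neg_cancel, hα] at h
    simpa using h
  · refine Or.inr ⟨α, Set.mem_biUnion (x := -∑ i, α i • da i) ?_ (neg_neg _).symm, rfl⟩
    simpa using hα

/-- Modulo an ideal containing the `b j`, the algebra generated by the `a i` and the `b j` is
spanned by the monomials in the `a i`. -/
lemma adjoin_le_span_monomials_sup {A : Type*} [CommRing A] [Algebra ℂ A] {n m : ℕ}
    (a : Fin n → A) (b : Fin m → A) (I : Ideal A) (hb : ∀ j, b j ∈ I) :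
    Subalgebra.toSubmodule (Algebra.adjoin ℂ (Set.range a ∪ Set.range b)) ≤
      Submodule.span ℂ (Set.range fun α : Fin n → ℕ => ∏ i, a i ^ α i) ⊔
        I.restrictScalars ℂ := by
  rw [Algebra.adjoin_eq_span, Submodule.span_le]
  intro x hx
  suffices h : (∃ α : Fin n → ℕ, ∏ i, a i ^ α i = x) ∨ x ∈ I from
    h.elim (fun h => Submodule.mem_sup_left (Submodule.subset_span h))
      (fun h => Submodule.mem_sup_right h)
  induction hx using Submonoid.closure_induction with
  | mem x hx =>
    rcases hx with ⟨i, rfl⟩ | ⟨j, rfl⟩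
    · exact Or.inl ⟨Pi.single i 1, by simp [Pi.single_apply, pow_ite]⟩
    · exact Or.inr (hb j)
  | one => exact Or.inl ⟨0, by simp⟩
  | mul x y _ _ hx hy =>
    rcases hx with ⟨α, rfl⟩ | hx
    · rcases hy with ⟨β, rfl⟩ | hy
      · exact Or.inl ⟨α + β, by simp [pow_add, Finset.prod_mul_distrib]⟩
      · exact Or.inr (I.mul_mem_left _ hy)
    · exact Or.inr (I.mul_mem_right _ hx)


/-- let `A` be a commutative `ℤ`-graded `ℂ`-algebra which is a finite
module over the subalgebra generated by finitely many homogeneous elements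
`a₁,…,aₙ` of positive degree and `b₁,…,bₘ` of negative degree.  If `I ⊆ A` is the
ideal generated by all homogeneous elements of strictly negative degree, then
`A₀/(A₀ ∩ I)` is a finite-dimensional `ℂ`-vector space. -/
theorem statement6 (A : Type*) [CommRing A] [Algebra ℂ A]
    (𝒜 : ℤ → Submodule ℂ A) [GradedAlgebra 𝒜]
    (n m : ℕ) (a : Fin n → A) (b : Fin m → A) (da : Fin n → ℤ) (db : Fin m → ℤ)
    (hda : ∀ i, 0 < da i) (hdb : ∀ j, db j < 0)
    (ha : ∀ i, a i ∈ 𝒜 (da i)) (hb : ∀ j, b j ∈ 𝒜 (db j))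
    (hfin : Module.Finite ↥(Algebra.adjoin ℂ (Set.range a ∪ Set.range b)) A) :
    FiniteDimensional ℂ
      (↥(𝒜 0) ⧸ Submodule.comap (𝒜 0).subtype
        ((Ideal.span {x : A | ∃ i : ℤ, i < 0 ∧ x ∈ 𝒜 i}).restrictScalars ℂ)) := by
  classical
  set I : Ideal A := Ideal.span {x : A | ∃ i : ℤ, i < 0 ∧ x ∈ 𝒜 i}
  have hI : I.IsHomogeneous 𝒜 := Ideal.homogeneous_span 𝒜 _ fun x ⟨i, _, hx⟩ => ⟨i, hx⟩
  have hbI : ∀ j, b j ∈ I := fun j => Ideal.subset_span ⟨db j, hdb j, hb j⟩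
  obtain ⟨S, hS⟩ := hfin.fg_top
  let p : A →ₗ[ℂ] ↥(𝒜 0) ⧸ Submodule.comap (𝒜 0).subtype (I.restrictScalars ℂ) :=
    (Submodule.mkQ _) ∘ₗ DirectSum.component ℂ ℤ (fun i => 𝒜 i) 0 ∘ₗ
      (DirectSum.decomposeLinearEquiv 𝒜).toLinearMap
  have hp (x : A) : p x = Submodule.Quotient.mk (DirectSum.decompose 𝒜 x 0) := rfl
  have hp_surj : Function.Surjective p := by
    intro q
    obtain ⟨x, rfl⟩ := Submodule.Quotient.mk_surjective _ q
    exact ⟨x, by rw [hp, DirectSum.decompose_coe, DirectSum.of_eq_same]⟩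
  have hpI (x : A) (hx : x ∈ I) : p x = 0 := by
    rw [hp, Submodule.Quotient.mk_eq_zero]
    exact hI 0 hx
  have hfinite : (⋃ s ∈ S, Set.range fun α : Fin n → ℕ => p ((∏ i, a i ^ α i) * s)).Finite :=
    S.finite_toSet.biUnion fun s _ =>
      finite_range_monomial_mul 𝒜 a da hda ha p
        (fun x hx => by rw [hp, hx, Submodule.Quotient.mk_zero]) s
  refine ⟨⟨hfinite.toFinset, ?_⟩⟩
  rw [Set.Finite.coe_toFinset, eq_top_iff]
  rintro q -
  obtain ⟨x, rfl⟩ := hp_surj q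
  have hx : x ∈ Submodule.span (Algebra.adjoin ℂ (Set.range a ∪ Set.range b)) (S : Set A) :=
    hS ▸ Submodule.mem_top
  obtain ⟨c, rfl⟩ := Submodule.mem_span_finset'.1 hx
  rw [map_sum]
  refine sum_mem fun s _ => ?_
  obtain ⟨w, hw, y, hy, hwy⟩ :=
    Submodule.mem_sup.1 (adjoin_le_span_monomials_sup a b I hbI (c s).2)
  rw [Subalgebra.smul_def, smul_eq_mul, ← hwy, add_mul, map_add,
    hpI _ (I.mul_mem_right _ hy), add_zero]
  refine (Submodule.span_le (p := Submodule.comap (p ∘ₗ LinearMap.mulRight ℂ (s : A))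
    (Submodule.span ℂ _))).2 ?_ hw
  rintro _ ⟨α, rfl⟩
  exact Submodule.subset_span (Set.mem_biUnion s.2 ⟨α, rfl⟩)
end

section
/- Let V be a finite-dimensional complex vector space and W a finite subgroup of GL(V), acting on V × V* diagonally (on V* via the inverse-transpose action). Let R = ℂ[V × V*] be the algebra of polynomial functions on V × V*, graded by declaring linear forms on V (elements of V*) to have degree +1 and linear forms on V* (elements of V) to have degree −1, and let A = R^W be the invariant subalgebra with the induced grading A_i = A ∩ R_i. Let I ⊆ A be the ideal generated by all homogeneous elements of A of strictly negative degree. Then A_0/(A_0 ∩ I) is a finite-dimensional ℂ-vector space. -/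
set_option maxHeartbeats 1000000
set_option synthInstance.maxHeartbeats 1000000

noncomputable section

variable (V : Type*) [AddCommGroup V] [Module ℂ V]

/-- The space `V × V*`. -/
abbrev PtSpace := V × Module.Dual ℂ V

/-- The diagonal action of a linear automorphism `w` of `V` on `V × V*`:
`w · (v, φ) = (w v, φ ∘ w⁻¹)` (inverse-transpose action on the dual). -/
def diagAct (w : V ≃ₗ[ℂ] V) (p : PtSpace V) : PtSpace V :=
  (w p.1, p.2.comp (w.symm : V ≃ₗ[ℂ] V).toLinearMap)

/-- Precomposition with a self-map, as a `ℂ`-algebra homomorphism of the algebra of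
all `ℂ`-valued functions. -/
def precompHom (g : PtSpace V → PtSpace V) : (PtSpace V → ℂ) →ₐ[ℂ] (PtSpace V → ℂ) where
  toFun f := f ∘ g
  map_one' := rfl
  map_mul' _ _ := rfl
  map_zero' := rfl
  map_add' _ _ := rfl
  commutes' _ := rfl

/-- The algebra `R = ℂ[V × V*]` of polynomial functions on `V × V*`: the subalgebra
of functions generated by the linear forms. -/
def polyFuns : Subalgebra ℂ (PtSpace V → ℂ) :=
  Algebra.adjoin ℂ {f : PtSpace V → ℂ | ∃ ψ : Module.Dual ℂ (PtSpace V), f = ⇑ψ}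

/-- The invariant algebra `A = R^W`: polynomial functions `f` with
`f(w v, φ ∘ w⁻¹) = f(v, φ)` for all `w ∈ W`. -/
def invPolyFuns (W : Subgroup (V ≃ₗ[ℂ] V)) : Subalgebra ℂ (PtSpace V → ℂ) :=
  polyFuns V ⊓ ⨅ w ∈ W, AlgHom.equalizer (precompHom V (diagAct V w)) (AlgHom.id ℂ _)

/-- `f` is homogeneous of degree `i` for the grading in which linear forms on `V`
have degree `+1` and linear forms on `V*` have degree `-1`:
`f (t • v, t⁻¹ • φ) = t ^ i * f (v, φ)` for every `t ∈ ℂˣ`. -/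
def IsHomogeneousFun (i : ℤ) (f : PtSpace V → ℂ) : Prop :=
  ∀ (t : ℂˣ) (p : PtSpace V),
    f ((t : ℂ) • p.1, ((t⁻¹ : ℂˣ) : ℂ) • p.2) = (t : ℂ) ^ i * f p

/-- The homogeneous functions of degree `i`, as a `ℂ`-subspace of all functions. -/
def homogFuns (i : ℤ) : Submodule ℂ (PtSpace V → ℂ) where
  carrier := {f | IsHomogeneousFun V i f}
  zero_mem' := by
    intro t p
    simp
  add_mem' := by
    intro f g hf hg t p
    simp only [Pi.add_apply, hf t p, hg t p]
    ring
  smul_mem' := by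
    intro c f hf t p
    simp only [Pi.smul_apply, smul_eq_mul, hf t p]
    ring

/-- The degree-`i` component `Aᵢ = A ∩ Rᵢ` of the invariant algebra. -/
def homogComponent (W : Subgroup (V ≃ₗ[ℂ] V)) (i : ℤ) : Submodule ℂ (PtSpace V → ℂ) :=
  Subalgebra.toSubmodule (invPolyFuns V W) ⊓ homogFuns V i

/-- The ideal `I ⊆ A` generated by all homogeneous elements of strictly negative
degree. -/
def negDegIdeal (W : Subgroup (V ≃ₗ[ℂ] V)) : Ideal ↥(invPolyFuns V W) :=
  Ideal.span {x : ↥(invPolyFuns V W) | ∃ i : ℤ, i < 0 ∧ IsHomogeneousFun V i ↑x}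

/-- The underlying `ℂ`-subspace of `I` inside the function algebra. -/
def negDegSubspace (W : Subgroup (V ≃ₗ[ℂ] V)) : Submodule ℂ (PtSpace V → ℂ) :=
  Submodule.map (invPolyFuns V W).val.toLinearMap ((negDegIdeal V W).restrictScalars ℂ)

section Homogeneous

variable {V}

lemma IsHomogeneousFun.mul {i j : ℤ} {f g : PtSpace V → ℂ} (hf : IsHomogeneousFun V i f)
    (hg : IsHomogeneousFun V j g) : IsHomogeneousFun V (i + j) (f * g) := by
  intro t p
  rw [Pi.mul_apply, hf t p, hg t p, zpow_add₀ t.ne_zero, Pi.mul_apply]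
  ring

lemma isHomogeneousFun_one : IsHomogeneousFun V 0 1 := by
  intro t p
  simp

lemma IsHomogeneousFun.pow {i : ℤ} {f : PtSpace V → ℂ} (hf : IsHomogeneousFun V i f) (n : ℕ) :
    IsHomogeneousFun V (n * i) (f ^ n) := by
  intro t p
  rw [Pi.pow_apply, hf t p, mul_pow, mul_comm (n : ℤ) i, zpow_mul, zpow_natCast, Pi.pow_apply]

lemma IsHomogeneousFun.prod {ι : Type*} (s : Finset ι) {i : ι → ℤ} {f : ι → PtSpace V → ℂ}
    (hf : ∀ k ∈ s, IsHomogeneousFun V (i k) (f k)) :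
    IsHomogeneousFun V (∑ k ∈ s, i k) (∏ k ∈ s, f k) := by
  classical
  induction s using Finset.induction_on with
  | empty => simpa using isHomogeneousFun_one
  | insert a s ha ih =>
    rw [Finset.sum_insert ha, Finset.prod_insert ha]
    exact (hf a (Finset.mem_insert_self a s)).mul
      (ih fun k hk => hf k (Finset.mem_insert_of_mem hk))

/-- The components of the grading are eigenspaces of a single scaling operator. -/
lemma iSupIndep_homogFuns : iSupIndep (homogFuns V) := by
  let T : Module.End ℂ (PtSpace V → ℂ) :=
    LinearMap.funLeft ℂ ℂ fun p : PtSpace V => ((2 : ℂ) • p.1, (2⁻¹ : ℂ) • p.2)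
  have hinj : Function.Injective fun k : ℤ => (2 : ℂ) ^ k := by
    intro a b h
    have h' : (2 : ℝ) ^ a = 2 ^ b := by
      simpa [norm_zpow] using congrArg norm h
    exact zpow_right_injective₀ (by norm_num) (by norm_num) h'
  refine ((Module.End.eigenspaces_iSupIndep T).comp hinj).mono fun k f hf => ?_
  rw [Function.comp_apply, Module.End.mem_eigenspace_iff]
  funext p
  simpa [T] using hf (Units.mk0 2 two_ne_zero) p

/-- The coefficients of a product of factors `X - u`, with each `u` homogeneous of degree `-1`,
are homogeneous. -/
lemma coeff_prod_X_sub_C_mem {ι : Type*} (s : Finset ι) (u : ι → PtSpace V → ℂ)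
    (A : Subalgebra ℂ (PtSpace V → ℂ)) (hA : ∀ i ∈ s, u i ∈ A)
    (hu : ∀ i ∈ s, IsHomogeneousFun V (-1) (u i)) (k : ℕ) :
    (∏ i ∈ s, (Polynomial.X - Polynomial.C (u i))).coeff k ∈ A ∧
      IsHomogeneousFun V (k - s.card) ((∏ i ∈ s, (Polynomial.X - Polynomial.C (u i))).coeff k) := by
  classical
  induction s using Finset.induction_on generalizing k with
  | empty =>
    rw [Finset.prod_empty, Polynomial.coeff_one]
    split_ifs with h
    · subst h
      exact ⟨A.one_mem, by simpa using isHomogeneousFun_one⟩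
    · exact ⟨A.zero_mem, (homogFuns V _).zero_mem⟩
  | insert a s ha ih =>
    have ih' := fun k => ih (fun i hi => hA i (Finset.mem_insert_of_mem hi))
      (fun i hi => hu i (Finset.mem_insert_of_mem hi)) k
    have hAa := hA a (Finset.mem_insert_self a s)
    have hua := hu a (Finset.mem_insert_self a s)
    rw [Finset.prod_insert ha, Finset.card_insert_of_notMem ha, mul_comm]
    have hmul : ∀ k : ℕ, IsHomogeneousFun V (k - (s.card + 1 : ℕ))
        ((∏ i ∈ s, (Polynomial.X - Polynomial.C (u i))).coeff k * u a) := by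
      intro k
      have h := (ih' k).2.mul hua
      rwa [show ((k : ℤ) - s.card + -1) = k - (s.card + 1 : ℕ) by push_cast; ring] at h
    cases k with
    | zero =>
      rw [Polynomial.mul_coeff_zero, Polynomial.coeff_sub, Polynomial.coeff_X_zero,
        Polynomial.coeff_C_zero, zero_sub, mul_neg]
      exact ⟨A.neg_mem (A.mul_mem (ih' 0).1 hAa), (homogFuns V _).neg_mem (hmul 0)⟩
    | succ k =>
      rw [Polynomial.coeff_mul_X_sub_C]
      refine ⟨A.sub_mem (ih' k).1 (A.mul_mem (ih' _).1 hAa),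
        (homogFuns V _).sub_mem ?_ (hmul (k + 1))⟩
      have h := (ih' k).2
      rwa [show ((k : ℤ) - s.card) = (k + 1 : ℕ) - (s.card + 1 : ℕ) by push_cast; ring] at h

end Homogeneous

section Action

variable {V}

lemma diagAct_one (p : PtSpace V) : diagAct V 1 p = p := rfl

lemma diagAct_mul (w g : V ≃ₗ[ℂ] V) (p : PtSpace V) :
    diagAct V (w * g) p = diagAct V w (diagAct V g p) := rfl

/-- The diagonal action of `w` as a linear map. -/
def diagActLinear (w : V ≃ₗ[ℂ] V) : PtSpace V →ₗ[ℂ] PtSpace V where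
  toFun := diagAct V w
  map_add' p q := by
    ext <;> simp [diagAct]
  map_smul' c p := by
    ext <;> simp [diagAct]

lemma comp_diagAct_mem_polyFuns (w : V ≃ₗ[ℂ] V) {f : PtSpace V → ℂ} (hf : f ∈ polyFuns V) :
    f ∘ diagAct V w ∈ polyFuns V := by
  have h : polyFuns V ≤ (polyFuns V).comap (precompHom V (diagAct V w)) := by
    refine Algebra.adjoin_le ?_
    rintro _ ⟨ψ, rfl⟩
    exact Algebra.subset_adjoin ⟨ψ.comp (diagActLinear w), rfl⟩
  exact h hf

lemma IsHomogeneousFun.comp_diagAct {i : ℤ} {f : PtSpace V → ℂ} (hf : IsHomogeneousFun V i f)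
    (w : V ≃ₗ[ℂ] V) : IsHomogeneousFun V i (f ∘ diagAct V w) := by
  intro t p
  have h : diagAct V w ((t : ℂ) • p.1, ((t⁻¹ : ℂˣ) : ℂ) • p.2) =
      ((t : ℂ) • (diagAct V w p).1, ((t⁻¹ : ℂˣ) : ℂ) • (diagAct V w p).2) := by
    ext <;> simp [diagAct]
  rw [Function.comp_apply, h, hf t, Function.comp_apply]

variable (W : Subgroup (V ≃ₗ[ℂ] V))

lemma mem_invPolyFuns_iff {f : PtSpace V → ℂ} :
    f ∈ invPolyFuns V W ↔ f ∈ polyFuns V ∧ ∀ w ∈ W, f ∘ diagAct V w = f := by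
  simp only [invPolyFuns, Algebra.mem_inf, Algebra.mem_iInf]
  rfl

lemma mul_mem_negDegSubspace {f g : PtSpace V → ℂ} (hf : f ∈ invPolyFuns V W)
    (hg : g ∈ invPolyFuns V W) {i : ℤ} (hi : i < 0) (hgi : IsHomogeneousFun V i g) :
    f * g ∈ negDegSubspace V W :=
  ⟨⟨f, hf⟩ * ⟨g, hg⟩, Ideal.mul_mem_left _ _ (Ideal.subset_span ⟨i, hi, hgi⟩), rfl⟩

variable [Fintype W]

/-- The Reynolds operator, averaging a function over `W`. -/
def reynolds : (PtSpace V → ℂ) →ₗ[ℂ] (PtSpace V → ℂ) :=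
  (Fintype.card W : ℂ)⁻¹ • ∑ w : W, (precompHom V (diagAct V w)).toLinearMap

lemma reynolds_apply (f : PtSpace V → ℂ) :
    reynolds W f = (Fintype.card W : ℂ)⁻¹ • ∑ w : W, f ∘ diagAct V w := by
  simp only [reynolds, LinearMap.smul_apply, LinearMap.sum_apply]
  rfl

lemma reynolds_mul_of_mem {f g : PtSpace V → ℂ} (hg : g ∈ invPolyFuns V W) :
    reynolds W (f * g) = reynolds W f * g := by
  rw [reynolds_apply, reynolds_apply, smul_mul_assoc, Finset.sum_mul]
  congr 1
  refine Finset.sum_congr rfl fun w _ => ?_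
  conv_rhs => rw [← ((mem_invPolyFuns_iff W).1 hg).2 w w.2]
  rfl

lemma reynolds_of_mem {f : PtSpace V → ℂ} (hf : f ∈ invPolyFuns V W) : reynolds W f = f := by
  rw [reynolds_apply, Finset.sum_congr rfl fun (w : W) _ => ((mem_invPolyFuns_iff W).1 hf).2 w w.2,
    Finset.sum_const, Finset.card_univ, ← Nat.cast_smul_eq_nsmul ℂ, smul_smul,
    inv_mul_cancel₀ (Nat.cast_ne_zero.2 Fintype.card_ne_zero), one_smul]

lemma reynolds_mem {f : PtSpace V → ℂ} (hf : f ∈ polyFuns V) :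
    reynolds W f ∈ invPolyFuns V W := by
  rw [mem_invPolyFuns_iff, reynolds_apply]
  refine ⟨(polyFuns V).smul_mem ((polyFuns V).sum_mem fun w _ =>
    comp_diagAct_mem_polyFuns _ hf) _, fun g hg => ?_⟩
  funext p
  simp only [Function.comp_apply, Pi.smul_apply, Finset.sum_apply]
  congr 1
  exact Fintype.sum_equiv (Equiv.mulRight ⟨g, hg⟩) _ _ fun w => rfl

/-- The average of a multiple of `f ^ |W|` lies in the ideal `I`, for `f` of degree `-1`: indeed
`f` is a root of the polynomial `∏ w, (X - w f)`, whose lower coefficients are invariants of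
negative degree. -/
lemma reynolds_mul_pow_card_mem {f r : PtSpace V → ℂ} (hf : f ∈ polyFuns V)
    (hf1 : IsHomogeneousFun V (-1) f) (hr : r ∈ polyFuns V) :
    reynolds W (r * f ^ Fintype.card W) ∈ negDegSubspace V W := by
  let P : Polynomial (PtSpace V → ℂ) :=
    ∏ w : W, (Polynomial.X - Polynomial.C (f ∘ diagAct V w))
  have hP : ∀ k, P.coeff k ∈ polyFuns V ∧
      IsHomogeneousFun V (k - Fintype.card W) (P.coeff k) :=
    coeff_prod_X_sub_C_mem Finset.univ (fun w : W => f ∘ diagAct V w) (polyFuns V)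
      (fun w _ => comp_diagAct_mem_polyFuns _ hf) (fun w _ => hf1.comp_diagAct _)
  have hinv : ∀ k, P.coeff k ∈ invPolyFuns V W := by
    refine fun k => (mem_invPolyFuns_iff W).2 ⟨(hP k).1, fun g hg => ?_⟩
    have hmap : P.map (precompHom V (diagAct V g)).toRingHom = P := by
      rw [Polynomial.map_prod]
      refine Fintype.prod_equiv (Equiv.mulRight ⟨g, hg⟩) _ _ fun w => ?_
      rw [Polynomial.map_sub, Polynomial.map_X, Polynomial.map_C]
      refine congrArg (fun u => Polynomial.X - Polynomial.C u) ?_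
      funext p
      rfl
    have hcoeff := congrArg (Polynomial.coeff · k) hmap
    simp only [Polynomial.coeff_map] at hcoeff
    exact hcoeff
  have hmonic : P.Monic := Polynomial.monic_prod_X_sub_C _ _
  have hdeg : P.natDegree = Fintype.card W := by
    simp only [P, Polynomial.natDegree_finsetProd_X_sub_C_eq_card, Finset.card_univ]
  have hroot : P.eval f = 0 := by
    rw [Polynomial.eval_prod]
    refine Finset.prod_eq_zero (Finset.mem_univ 1) ?_
    rw [Polynomial.eval_sub, Polynomial.eval_X, Polynomial.eval_C, sub_eq_zero]
    rfl
  have hpow : f ^ Fintype.card W =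
      -∑ k ∈ Finset.range (Fintype.card W), P.coeff k * f ^ k := by
    have hlead : P.coeff (Fintype.card W) = 1 := hdeg ▸ hmonic.coeff_natDegree
    rw [Polynomial.eval_eq_sum_range, hdeg, Finset.sum_range_succ, hlead, one_mul] at hroot
    exact eq_neg_of_add_eq_zero_right hroot
  rw [hpow, mul_neg, map_neg, Finset.mul_sum, map_sum]
  refine Submodule.neg_mem _ (Submodule.sum_mem _ fun k hk => ?_)
  rw [mul_left_comm, mul_comm, reynolds_mul_of_mem W (hinv k)]
  exact mul_mem_negDegSubspace W
    (reynolds_mem W ((polyFuns V).mul_mem hr ((polyFuns V).pow_mem hf k))) (hinv k)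
    (by have := Finset.mem_range.1 hk; omega) (hP k).2

end Action

section Monomials

variable {V} {ι : Type*} (b : Module.Basis ι ℂ V)

/-- The `i`-th coordinate on `V`, as a function on `V × V*`. -/
def posCoord (i : ι) : PtSpace V → ℂ := fun p => b.coord i p.1

/-- The `i`-th coordinate on `V*`, as a function on `V × V*`. -/
def negCoord (i : ι) : PtSpace V → ℂ := fun p => p.2 (b i)

lemma posCoord_mem (i : ι) : posCoord b i ∈ polyFuns V :=
  Algebra.subset_adjoin ⟨(b.coord i).comp (LinearMap.fst ℂ V _), rfl⟩

lemma negCoord_mem (i : ι) : negCoord b i ∈ polyFuns V :=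
  Algebra.subset_adjoin ⟨(LinearMap.applyₗ (b i)).comp (LinearMap.snd ℂ V _), rfl⟩

lemma isHomogeneousFun_posCoord (i : ι) : IsHomogeneousFun V 1 (posCoord b i) := by
  intro t p
  simp [posCoord]

lemma isHomogeneousFun_negCoord (i : ι) : IsHomogeneousFun V (-1) (negCoord b i) := by
  intro t p
  simp [negCoord]

variable [Fintype ι]

/-- The monomial with exponents `a` in the coordinates on `V` and `c` in those on `V*`. -/
def coordMonomial (m : (ι → ℕ) × (ι → ℕ)) : PtSpace V → ℂ :=
  (∏ i, posCoord b i ^ m.1 i) * ∏ i, negCoord b i ^ m.2 i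

lemma isHomogeneousFun_coordMonomial (m : (ι → ℕ) × (ι → ℕ)) :
    IsHomogeneousFun V ((∑ i, m.1 i : ℕ) - (∑ i, m.2 i : ℕ)) (coordMonomial b m) := by
  have h := (IsHomogeneousFun.prod Finset.univ fun i _ =>
    (isHomogeneousFun_posCoord b i).pow (m.1 i)).mul
      (IsHomogeneousFun.prod Finset.univ fun i _ => (isHomogeneousFun_negCoord b i).pow (m.2 i))
  convert h using 1
  · push_cast
    simp [sub_eq_add_neg]
  · rfl

lemma polyFuns_le_span_range_coordMonomial :
    Subalgebra.toSubmodule (polyFuns V) ≤ Submodule.span ℂ (Set.range (coordMonomial b)) := by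
  classical
  have hgen : polyFuns V ≤
      Algebra.adjoin ℂ (Set.range (posCoord b) ∪ Set.range (negCoord b)) := by
    refine Algebra.adjoin_le ?_
    rintro _ ⟨ψ, rfl⟩
    have hψ : (⇑ψ : PtSpace V → ℂ) = ∑ i, ψ (b i, 0) • posCoord b i +
        ∑ i, ψ (0, b.coord i) • negCoord b i := by
      funext p
      have hp : p = ∑ i, b.coord i p.1 • ((b i, 0) : PtSpace V) +
          ∑ i, p.2 (b i) • ((0, b.coord i) : PtSpace V) := by
        ext <;> simp [Prod.fst_sum, Prod.snd_sum]
      conv_lhs => rw [hp]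
      simp only [map_add, map_sum, map_smul, smul_eq_mul, Pi.add_apply, Finset.sum_apply,
        Pi.smul_apply, posCoord, negCoord, mul_comm]
    rw [SetLike.mem_coe, hψ]
    refine Subalgebra.add_mem _ (Subalgebra.sum_mem _ fun i _ => Subalgebra.smul_mem _ ?_ _)
      (Subalgebra.sum_mem _ fun i _ => Subalgebra.smul_mem _ ?_ _)
    · exact Algebra.subset_adjoin (Or.inl ⟨i, rfl⟩)
    · exact Algebra.subset_adjoin (Or.inr ⟨i, rfl⟩)
  refine (Subalgebra.toSubmodule.monotone hgen).trans ?_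
  rw [Algebra.adjoin_eq_span]
  refine Submodule.span_mono fun f hf => ?_
  induction hf using Submonoid.closure_induction with
  | mem f hf =>
    rcases hf with ⟨i, rfl⟩ | ⟨i, rfl⟩
    · refine ⟨(Pi.single i 1, 0), ?_⟩
      simp [coordMonomial, Pi.single_apply, pow_ite]
    · refine ⟨(0, Pi.single i 1), ?_⟩
      simp [coordMonomial, Pi.single_apply, pow_ite]
  | one => exact ⟨0, by simp [coordMonomial]⟩
  | mul f g _ _ hf hg =>
    obtain ⟨m, rfl⟩ := hf
    obtain ⟨n, rfl⟩ := hg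
    refine ⟨m + n, ?_⟩
    simp only [coordMonomial, Prod.fst_add, Prod.snd_add, Pi.add_apply, pow_add,
      Finset.prod_mul_distrib]
    ring

/-- A polynomial function of degree `0` is a combination of monomials of degree `0`. -/
lemma mem_span_coordMonomial_of_isHomogeneousFun_zero {f : PtSpace V → ℂ} (hf : f ∈ polyFuns V)
    (hf0 : IsHomogeneousFun V 0 f) :
    f ∈ Submodule.span ℂ (coordMonomial b '' {m | ∑ i, m.1 i = ∑ i, m.2 i}) := by
  have hspan := polyFuns_le_span_range_coordMonomial b hf
  rw [← Set.image_univ, ← Set.union_compl_self {m : (ι → ℕ) × (ι → ℕ) | ∑ i, m.1 i = ∑ i, m.2 i},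
    Set.image_union, Submodule.span_union] at hspan
  obtain ⟨g, hg, h, hh, rfl⟩ := Submodule.mem_sup.1 hspan
  have hg0 : g ∈ homogFuns V 0 := by
    refine Submodule.span_le.2 ?_ hg
    rintro _ ⟨m, hm, rfl⟩
    have := isHomogeneousFun_coordMonomial b m
    rwa [show ∑ i, m.1 i = ∑ i, m.2 i from hm, sub_self] at this
  have hh0 : h ∈ homogFuns V 0 := by
    have := (homogFuns V 0).sub_mem hf0 hg0
    rwa [add_sub_cancel_left] at this
  have hh1 : h ∈ ⨆ (k : ℤ) (_ : k ≠ 0), homogFuns V k := by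
    refine Submodule.span_le.2 ?_ hh
    rintro _ ⟨m, hm, rfl⟩
    refine Submodule.mem_iSup_of_mem _ (Submodule.mem_iSup_of_mem ?_
      (isHomogeneousFun_coordMonomial b m))
    have hm' : ∑ i, m.1 i ≠ ∑ i, m.2 i := hm
    omega
  rw [Submodule.disjoint_def.1 (iSupIndep_homogFuns (V := V) 0) h hh0 hh1, add_zero]
  exact hg

lemma reynolds_coordMonomial_mem (W : Subgroup (V ≃ₗ[ℂ] V)) [Fintype W]
    (m : (ι → ℕ) × (ι → ℕ)) {j : ι} (hj : Fintype.card W ≤ m.2 j) :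
    reynolds W (coordMonomial b m) ∈ negDegSubspace V W := by
  classical
  have hm : coordMonomial b m = ((∏ i, posCoord b i ^ m.1 i) *
      (negCoord b j ^ (m.2 j - Fintype.card W) *
        ∏ i ∈ Finset.univ.erase j, negCoord b i ^ m.2 i)) * negCoord b j ^ Fintype.card W := by
    rw [coordMonomial,
      ← Finset.mul_prod_erase _ (fun i => negCoord b i ^ m.2 i) (Finset.mem_univ j),
      ← pow_sub_mul_pow (negCoord b j) hj]
    ring
  rw [hm]
  refine reynolds_mul_pow_card_mem W (negCoord_mem b j) (isHomogeneousFun_negCoord b j) ?_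
  exact Subalgebra.mul_mem _
    (Subalgebra.prod_mem _ fun i _ => Subalgebra.pow_mem _ (posCoord_mem b i) _)
    (Subalgebra.mul_mem _ (Subalgebra.pow_mem _ (negCoord_mem b j) _)
      (Subalgebra.prod_mem _ fun i _ => Subalgebra.pow_mem _ (negCoord_mem b i) _))

end Monomials

lemma finite_setOf_sum_eq_and_lt (ι : Type*) [Fintype ι] (n : ℕ) :
    {m : (ι → ℕ) × (ι → ℕ) | ∑ i, m.1 i = ∑ i, m.2 i ∧ ∀ i, m.2 i < n}.Finite := by
  classical
  refine ((Set.finite_Iic fun _ : ι => Fintype.card ι * n).prod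
    (Set.finite_Iic fun _ : ι => n)).subset ?_
  rintro m ⟨hm, hn⟩
  refine ⟨fun i => ?_, fun i => (hn i).le⟩
  calc m.1 i ≤ ∑ i, m.1 i := Finset.single_le_sum (fun _ _ => Nat.zero_le _) (Finset.mem_univ i)
    _ = ∑ i, m.2 i := hm
    _ ≤ ∑ _i : ι, n := Finset.sum_le_sum fun i _ => (hn i).le
    _ = Fintype.card ι * n := by simp

lemma Submodule.finiteDimensional_quotient_comap_subtype {K M : Type*} [Field K] [AddCommGroup M]
    [Module K M] {A N F : Submodule K M} [FiniteDimensional K F] (h : A ≤ F ⊔ N) :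
    FiniteDimensional K (A ⧸ N.comap A.subtype) := by
  let φ : A →ₗ[K] M ⧸ N := N.mkQ.comp A.subtype
  have hker : N.comap A.subtype = LinearMap.ker φ := by
    rw [LinearMap.ker_comp, Submodule.ker_mkQ]
  have hrange : LinearMap.range φ ≤ F.map N.mkQ := by
    rw [LinearMap.range_comp, Submodule.range_subtype]
    refine (Submodule.map_mono h).trans ?_
    rw [Submodule.map_sup, Submodule.mkQ_map_self, sup_bot_eq]
  have := Submodule.finiteDimensional_of_le hrange
  rw [hker]
  exact φ.quotKerEquivRange.symm.finiteDimensional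

/-- for a finite subgroup `W ⊆ GL(V)` of a finite-dimensional complex
vector space `V`, with `A = ℂ[V × V*]^W` graded as above and `I ⊆ A` the ideal
generated by the homogeneous elements of negative degree, the quotient
`A₀/(A₀ ∩ I)` is a finite-dimensional `ℂ`-vector space. -/
theorem statement7 [FiniteDimensional ℂ V]
    (W : Subgroup (V ≃ₗ[ℂ] V)) [Finite ↥W] :
    FiniteDimensional ℂ
      (↥(homogComponent V W 0) ⧸ Submodule.comap (homogComponent V W 0).subtype
        (negDegSubspace V W)) := by
  classical
  have := Fintype.ofFinite W
  let b := Module.finBasis ℂ V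
  let S : Set ((Fin (Module.finrank ℂ V) → ℕ) × (Fin (Module.finrank ℂ V) → ℕ)) :=
    {m | ∑ i, m.1 i = ∑ i, m.2 i ∧ ∀ i, m.2 i < Fintype.card W}
  have hS : S.Finite := finite_setOf_sum_eq_and_lt _ _
  let F : Submodule ℂ (PtSpace V → ℂ) :=
    (Submodule.span ℂ (coordMonomial b '' S)).map (reynolds W)
  have : FiniteDimensional ℂ (Submodule.span ℂ (coordMonomial b '' S)) :=
    FiniteDimensional.span_of_finite ℂ (hS.image _)
  refine Submodule.finiteDimensional_quotient_comap_subtype (F := F) ?_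
  rintro f ⟨hfA, hf0⟩
  have hf := mem_span_coordMonomial_of_isHomogeneousFun_zero b
    ((mem_invPolyFuns_iff W).1 hfA).1 hf0
  rw [← reynolds_of_mem W hfA]
  have hle : Submodule.span ℂ (coordMonomial b '' {m | ∑ i, m.1 i = ∑ i, m.2 i}) ≤
      (F ⊔ negDegSubspace V W).comap (reynolds W) := by
    refine Submodule.span_le.2 ?_
    rintro _ ⟨m, hm, rfl⟩
    by_cases hlt : ∀ i, m.2 i < Fintype.card W
    · exact Submodule.mem_sup_left
        (Submodule.mem_map_of_mem (Submodule.subset_span ⟨m, ⟨hm, hlt⟩, rfl⟩))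
    · obtain ⟨j, hj⟩ := not_forall.1 hlt
      exact Submodule.mem_sup_right (reynolds_coordMonomial_mem b W m (not_lt.1 hj))
  exact hle hf

end
end

section
/- Fix integers ℓ ≥ 1 and n ≥ 3. For λ ∈ P_ℓ(n), let R(λ) ⊆ P_ℓ(n−1) denote the set of ℓ-multipartitions obtained from λ by removing a single removable box from one of its components. If λ, μ ∈ P_ℓ(n) satisfy R(λ) = R(μ), then λ = μ; that is, an ℓ-multipartition of n with n ≥ 3 is uniquely determined by the set of ℓ-multipartitions obtained from it by removing a box. -/
/-- If every lower subset of `L` with one element fewer lies in `M`, then an element of `L` outside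
`M` is the greatest element of `L`. -/
lemma le_of_lowerSubsets_subset {α : Type*} [PartialOrder α] [DecidableEq α] {L M : Finset α}
    (hL : IsLowerSet (L : Set α))
    (h : ∀ N : Finset α, IsLowerSet (N : Set α) → N ⊆ L → N.card = L.card - 1 → N ⊆ M)
    {x z : α} (hx : x ∈ L) (hxM : x ∉ M) (hz : z ∈ L) : z ≤ x := by
  obtain ⟨w, hzw, hw⟩ := L.exists_le_maximal hz
  by_cases hwx : w = x
  · exact hwx ▸ hzw
  refine absurd (h (L.erase w) ?_ (L.erase_subset w) (Finset.card_erase_of_mem hw.prop)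
    (Finset.mem_erase.2 ⟨Ne.symm hwx, hx⟩)) hxM
  intro a b hba ha
  simp only [Finset.coe_erase, Set.mem_sdiff, Finset.mem_coe, Set.mem_singleton_iff] at ha ⊢
  refine ⟨hL hba ha.1, ?_⟩
  rintro rfl
  exact ha.2 (hw.eq_of_ge ha.1 hba)

/-- If every lower subset of `L` with one element fewer lies in `M`, then all elements of `L`
strictly below an element of `L` outside `M` lie in `M`. -/
lemma mem_of_lt_of_lowerSubsets_subset {α : Type*} [PartialOrder α] [DecidableEq α]
    {L M : Finset α} (hL : IsLowerSet (L : Set α))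
    (h : ∀ N : Finset α, IsLowerSet (N : Set α) → N ⊆ L → N.card = L.card - 1 → N ⊆ M)
    {x z : α} (hx : x ∈ L) (hxM : x ∉ M) (hz : z < x) : z ∈ M := by
  refine h (L.erase x) ?_ (L.erase_subset x) (Finset.card_erase_of_mem hx)
    (Finset.mem_erase.2 ⟨hz.ne, hL hz.le hx⟩)
  intro a b hba ha
  simp only [Finset.coe_erase, Set.mem_sdiff, Finset.mem_coe, Set.mem_singleton_iff] at ha ⊢
  refine ⟨hL hba ha.1, ?_⟩
  rintro rfl
  exact ha.2 (le_antisymm (le_of_lowerSubsets_subset hL h hx hxM ha.1) hba)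

/-- Two incomparable elements of a disjoint union of copies of `ℕ × ℕ` with the same elements
strictly below them are minimal or cover the least element of their copy. -/
lemma add_le_one_of_incomparable {ι : Type*} {j k : ι} {a b c d : ℕ}
    (hxy : ¬ (⟨j, (a, b)⟩ : Σ _ : ι, ℕ × ℕ) ≤ ⟨k, (c, d)⟩)
    (hyx : ¬ (⟨k, (c, d)⟩ : Σ _ : ι, ℕ × ℕ) ≤ ⟨j, (a, b)⟩)
    (hx : ∀ z : Σ _ : ι, ℕ × ℕ, z < ⟨j, (a, b)⟩ → z ≤ ⟨k, (c, d)⟩)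
    (hy : ∀ z : Σ _ : ι, ℕ × ℕ, z < ⟨k, (c, d)⟩ → z ≤ ⟨j, (a, b)⟩) :
    a + b ≤ 1 := by
  by_cases hjk : j = k
  · subst hjk
    simp only [Sigma.mk_le_mk_iff, Prod.mk_le_mk] at hxy hyx
    have hx' (p q : ℕ) (hp : p ≤ a) (hq : q ≤ b) (hpq : p < a ∨ q < b) : p ≤ c ∧ q ≤ d := by
      have := hx ⟨j, (p, q)⟩ (Sigma.mk_lt_mk_iff.2 (Prod.mk_lt_mk.2 (by omega)))
      simpa using this
    have hy' (p q : ℕ) (hp : p ≤ c) (hq : q ≤ d) (hpq : p < c ∨ q < d) : p ≤ a ∧ q ≤ b := by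
      have := hy ⟨j, (p, q)⟩ (Sigma.mk_lt_mk_iff.2 (Prod.mk_lt_mk.2 (by omega)))
      simpa using this
    have h₁ := hx' (a - 1) b
    have h₂ := hx' a (b - 1)
    have h₃ := hy' (c - 1) d
    have h₄ := hy' c (d - 1)
    omega
  · by_contra! hab
    have hlt : (⟨j, (0, 0)⟩ : Σ _ : ι, ℕ × ℕ) < ⟨j, (a, b)⟩ :=
      Sigma.mk_lt_mk_iff.2 (Prod.mk_lt_mk.2 (by omega))
    exact hjk (Sigma.le_def.1 (hx _ hlt)).1

/-- A finite lower set with at least three elements in a disjoint union of copies of `ℕ × ℕ` is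
determined by its lower subsets with one element fewer. -/
lemma eq_of_lowerSubsets_iff {ι : Type*} [DecidableEq ι] {L M : Finset (Σ _ : ι, ℕ × ℕ)}
    (hL : IsLowerSet (L : Set (Σ _ : ι, ℕ × ℕ))) (hM : IsLowerSet (M : Set (Σ _ : ι, ℕ × ℕ)))
    (hcard : L.card = M.card) (hL3 : 3 ≤ L.card)
    (h : ∀ N : Finset (Σ _ : ι, ℕ × ℕ), IsLowerSet (N : Set (Σ _ : ι, ℕ × ℕ)) →
      N.card = L.card - 1 → (N ⊆ L ↔ N ⊆ M)) : L = M := by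
  by_contra hne
  obtain ⟨x, hxL, hxM⟩ := Finset.not_subset.1
    fun hs => hne (Finset.eq_of_subset_of_card_le hs hcard.ge)
  obtain ⟨y, hyM, hyL⟩ := Finset.not_subset.1
    fun hs => hne (Finset.eq_of_subset_of_card_le hs hcard.le).symm
  have hLM N hN hNL hc := (h N hN hc).1 hNL
  have hML N hN hNM hc := (h N hN (hcard ▸ hc)).2 hNM
  obtain ⟨j, a, b⟩ := x
  obtain ⟨k, c, d⟩ := y
  have hab : a + b ≤ 1 := add_le_one_of_incomparable
    (fun hle => hxM (hM hle hyM)) (fun hle => hyL (hL hle hxL))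
    (fun z hz => le_of_lowerSubsets_subset hM hML hyM hyL
      (mem_of_lt_of_lowerSubsets_subset hL hLM hxL hxM hz))
    (fun z hz => le_of_lowerSubsets_subset hL hLM hxL hxM
      (mem_of_lt_of_lowerSubsets_subset hM hML hyM hyL hz))
  have hsub : L ⊆ {⟨j, (0, 0)⟩, ⟨j, (a, b)⟩} := by
    rintro ⟨i, p, q⟩ hz
    have hle := le_of_lowerSubsets_subset hL hLM hxL hxM hz
    obtain rfl : i = j := (Sigma.le_def.1 hle).1
    simp only [Sigma.mk_le_mk_iff, Prod.mk_le_mk] at hle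
    simp only [Finset.mem_insert, Finset.mem_singleton, Sigma.mk.injEq, heq_eq_eq, true_and,
      Prod.mk.injEq]
    omega
  have := (Finset.card_le_card hsub).trans Finset.card_le_two
  omega

/-- The boxes of a tuple of Young diagrams form a lower set in the disjoint union of the grids. -/
lemma isLowerSet_sigma_cells {ι : Type*} [Fintype ι] (l : ι → YoungDiagram) :
    IsLowerSet ((Finset.univ.sigma fun j => (l j).cells : Finset (Σ _ : ι, ℕ × ℕ)) :
      Set (Σ _ : ι, ℕ × ℕ)) := by
  rintro ⟨i, p⟩ ⟨j, q⟩ hle hp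
  obtain rfl : j = i := (Sigma.le_def.1 hle).1
  simp only [Finset.coe_sigma, Set.mem_sigma_iff, Finset.mem_coe, Finset.mem_univ,
    true_and] at hp ⊢
  exact (l j).isLowerSet (Sigma.mk_le_mk_iff.1 hle) hp

/-- Every finite lower set in a disjoint union of grids is the set of boxes of a tuple of Young
diagrams. -/
lemma exists_sigma_cells_eq {ι : Type*} [Fintype ι] {N : Finset (Σ _ : ι, ℕ × ℕ)}
    (hN : IsLowerSet (N : Set (Σ _ : ι, ℕ × ℕ))) :
    ∃ ν : ι → YoungDiagram, (Finset.univ.sigma fun j => (ν j).cells) = N := by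
  have hinj (j : ι) : Function.Injective fun p : ℕ × ℕ => (⟨j, p⟩ : Σ _ : ι, ℕ × ℕ) :=
    fun p q hpq => by simpa using hpq
  refine ⟨fun j => ⟨N.preimage (fun p => ⟨j, p⟩) (hinj j).injOn, ?_⟩, ?_⟩
  · intro p q hqp hp
    simp only [Finset.coe_preimage, Set.mem_preimage] at hp ⊢
    exact hN (Sigma.mk_le_mk_iff.2 hqp) hp
  · ext ⟨j, p⟩
    simp

lemma sigma_cells_subset_iff {ι : Type*} [Fintype ι] {l m : ι → YoungDiagram} :
    (Finset.univ.sigma fun j => (l j).cells : Finset (Σ _ : ι, ℕ × ℕ)) ⊆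
      (Finset.univ.sigma fun j => (m j).cells) ↔ ∀ j, l j ≤ m j := by
  refine ⟨fun h j p hp => ?_, fun h => Finset.sigma_mono subset_rfl h⟩
  have := @h ⟨j, p⟩ (by simpa using hp)
  simpa using this

/-- for `ℓ ≥ 1` and `n ≥ 3`, an `ℓ`-multipartition of `n` is uniquely
determined by the set of `ℓ`-multipartitions of `n - 1` obtained from it by removing
a single box.  (Multipartitions are modelled as `ℓ`-tuples of Young diagrams; `μ` is
obtained from `λ` by removing one box iff `μ ≤ λ` componentwise and `μ` has total
size `n - 1`.) -/
theorem statement8 (ℓ n : ℕ) (hℓ : 1 ≤ ℓ) (hn : 3 ≤ n)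
    (l m : Fin ℓ → YoungDiagram)
    (hl : ∑ j, (l j).card = n) (hm : ∑ j, (m j).card = n)
    (h : {ν : Fin ℓ → YoungDiagram | (∀ j, ν j ≤ l j) ∧ ∑ j, (ν j).card = n - 1}
       = {ν : Fin ℓ → YoungDiagram | (∀ j, ν j ≤ m j) ∧ ∑ j, (ν j).card = n - 1}) :
    l = m := by
  have hL := (Finset.card_sigma Finset.univ fun j => (l j).cells).trans hl
  have hM := (Finset.card_sigma Finset.univ fun j => (m j).cells).trans hm
  have heq := eq_of_lowerSubsets_iff (isLowerSet_sigma_cells l) (isLowerSet_sigma_cells m)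
    (hL.trans hM.symm) (hn.trans_eq hL.symm) (by
      intro N hN hc
      obtain ⟨ν, rfl⟩ := exists_sigma_cells_eq hN
      rw [Finset.card_sigma, hL] at hc
      rw [sigma_cells_subset_iff, sigma_cells_subset_iff]
      have := Set.ext_iff.1 h ν
      simpa only [Set.mem_ofPred_eq, hc, and_true] using this)
  funext j
  exact le_antisymm (sigma_cells_subset_iff.1 heq.subset j) (sigma_cells_subset_iff.1 heq.ge j)
end

section
/- Let λ be a partition with at least two nonzero parts such that λ_1 = λ_2 and λ_1 ≥ 2. Let m be the largest index with λ_m = λ_1 (so m ≥ 2), and let r be the number of nonzero parts of λ. Define μ by μ_1 = λ_1 + 1, μ_m = λ_1 − 1, and μ_i = λ_i for i ≠ 1, m; define ν by ν_m = λ_1 − 1 and ν_i = λ_i for i ≠ m. Then μ and ν are partitions, the maximum of the hook lengths of λ equals λ_1 + r − 1, the maximum of the hook lengths of ν equals λ_1 + r − 1, and the maximum of the hook lengths of μ equals λ_1 + r; in particular, the maximal hook length of μ is strictly greater than the maximal hook lengths of λ and of ν. -/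
/-- The transposed partition evaluated at column `j`: the number of (1-indexed) rows
`i` with `p i ≥ j`. -/
noncomputable def conjPart (p : ℕ → ℕ) (j : ℕ) : ℕ := Set.ncard {i : ℕ | 1 ≤ i ∧ j ≤ p i}

/-- The hook length of the box in (1-indexed) row `i` and column `j`:
`h(i,j) = (λ_i − j) + (λ^t_j − i) + 1`. -/
noncomputable def hookLen (p : ℕ → ℕ) (i j : ℕ) : ℕ := (p i - j) + (conjPart p j - i) + 1

/-- The maximum of the hook lengths of the boxes of the partition `p`. -/
noncomputable def maxHook (p : ℕ → ℕ) : ℕ :=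
  sSup {h : ℕ | ∃ i j : ℕ, 1 ≤ i ∧ 1 ≤ j ∧ j ≤ p i ∧ h = hookLen p i j}

/-- `p` (read on indices `≥ 1`) is a partition: weakly decreasing with finitely many
nonzero parts. -/
def IsPartitionSeq (p : ℕ → ℕ) : Prop :=
  (∀ i, 1 ≤ i → p (i + 1) ≤ p i) ∧ ∃ N, ∀ i, N ≤ i → p i = 0

theorem IsPartitionSeq.le_one {q : ℕ → ℕ} (hq : IsPartitionSeq q) {i : ℕ} (hi : 1 ≤ i) :
    q i ≤ q 1 := by
  induction i, hi using Nat.le_induction with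
  | base => exact le_rfl
  | succ n hn ih => exact (hq.1 n hn).trans ih

theorem conjPart_one {q : ℕ → ℕ} {r : ℕ} (hr : ∀ i, 1 ≤ i → (q i ≠ 0 ↔ i ≤ r)) :
    conjPart q 1 = r := by
  have h : {i : ℕ | 1 ≤ i ∧ 1 ≤ q i} = (Finset.Icc 1 r : Finset ℕ) := by
    ext i
    simp only [Set.mem_ofPred_eq, Finset.coe_Icc, Set.mem_Icc]
    refine and_congr_right fun hi => ?_
    rw [← hr i hi, Nat.one_le_iff_ne_zero]
  rw [conjPart, h, Set.ncard_coe_finset, Nat.card_Icc, Nat.add_sub_cancel]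

theorem conjPart_le {q : ℕ → ℕ} {r j : ℕ} (hr : ∀ i, 1 ≤ i → (q i ≠ 0 ↔ i ≤ r))
    (hj : 1 ≤ j) : conjPart q j ≤ r := by
  rw [← conjPart_one hr]
  refine Set.ncard_le_ncard (fun i hi => ⟨hi.1, hj.trans hi.2⟩) ?_
  refine (Set.finite_Icc 1 r).subset fun i hi => ⟨hi.1, (hr i hi.1).1 ?_⟩
  exact Nat.one_le_iff_ne_zero.1 hi.2

/-- The largest hook length of a nonempty partition is that of its corner box. -/
theorem maxHook_eq {q : ℕ → ℕ} (hq : IsPartitionSeq q) (h1 : 1 ≤ q 1) {r : ℕ}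
    (hr : ∀ i, 1 ≤ i → (q i ≠ 0 ↔ i ≤ r)) : maxHook q = q 1 + r - 1 := by
  have hr1 : 1 ≤ r := (hr 1 le_rfl).1 (by omega)
  refine IsGreatest.csSup_eq ⟨⟨1, 1, le_rfl, le_rfl, h1, ?_⟩, ?_⟩
  · rw [hookLen, conjPart_one hr]
    omega
  · rintro h ⟨i, j, hi, hj, -, rfl⟩
    have hqi := hq.le_one hi
    have hcj := conjPart_le hr hj
    rw [hookLen]
    omega

/-- let `λ` be a partition with `λ₁ = λ₂`, `λ₁ ≥ 2`, let `m` be the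
largest index with `λ_m = λ₁` and `r` the number of nonzero parts.  Define `μ` by
moving the box at the end of row `m` to row 1, and `ν` by removing it.  Then `μ, ν`
are partitions, `maxHook λ = λ₁ + r − 1 = maxHook ν` while `maxHook μ = λ₁ + r`;
in particular the maximal hook length of `μ` is strictly bigger than those of `λ`
and `ν`. -/
theorem statement9 (p : ℕ → ℕ) (hpart : IsPartitionSeq p)
    (h12 : p 2 = p 1) (h1 : 2 ≤ p 1)
    (r : ℕ) (hr : ∀ i, 1 ≤ i → (p i ≠ 0 ↔ i ≤ r))
    (m : ℕ) (hm : ∀ i, 1 ≤ i → (p i = p 1 ↔ i ≤ m)) :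
    IsPartitionSeq (fun i => if i = 1 then p 1 + 1 else if i = m then p 1 - 1 else p i) ∧
    IsPartitionSeq (fun i => if i = m then p 1 - 1 else p i) ∧
    maxHook p = p 1 + r - 1 ∧
    maxHook (fun i => if i = m then p 1 - 1 else p i) = p 1 + r - 1 ∧
    maxHook (fun i => if i = 1 then p 1 + 1 else if i = m then p 1 - 1 else p i)
      = p 1 + r ∧
    maxHook p <
      maxHook (fun i => if i = 1 then p 1 + 1 else if i = m then p 1 - 1 else p i) ∧
    maxHook (fun i => if i = m then p 1 - 1 else p i) <
      maxHook (fun i => if i = 1 then p 1 + 1 else if i = m then p 1 - 1 else p i) := by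
  have hm2 : 2 ≤ m := (hm 2 (by norm_num)).1 h12
  have hpm : p m = p 1 := (hm m (by omega)).2 le_rfl
  have hnext : p (m + 1) < p 1 := by
    refine lt_of_le_of_ne (hpart.le_one (by omega)) fun h => ?_
    have := (hm (m + 1) (by omega)).1 h
    omega
  obtain ⟨N, hN⟩ := hpart.2
  have hmN : m < N := by
    by_contra! h
    have := hN m h
    omega
  have hν : IsPartitionSeq (fun i => if i = m then p 1 - 1 else p i) := by
    refine ⟨fun i hi => ?_, N, fun i hi => ?_⟩
    · have hstep := hpart.1 i hi
      have hle := hpart.le_one hi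
      dsimp only
      split_ifs with ha hb hb
      · omega
      · have := (hm i hi).2 (by omega)
        omega
      · subst hb
        omega
      · exact hstep
    · dsimp only
      rw [if_neg (by omega), hN i hi]
  have hμ : IsPartitionSeq
      (fun i => if i = 1 then p 1 + 1 else if i = m then p 1 - 1 else p i) := by
    refine ⟨fun i hi => ?_, N, fun i hi => ?_⟩
    · have hstep := hν.1 i hi
      have hle := hν.le_one (i := i + 1) (by omega)
      dsimp only at hstep hle ⊢
      rw [if_neg (show ¬ i + 1 = 1 by omega)]
      rw [if_neg (show ¬ 1 = m by omega)] at hle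
      by_cases h : i = 1
      · rw [if_pos h]
        omega
      · rw [if_neg h]
        exact hstep
    · dsimp only
      rw [if_neg (by omega), if_neg (by omega), hN i hi]
  have hrm : ∀ i, i = m → i ≤ r := fun i hi => by
    subst hi
    exact (hr i (by omega)).1 (by omega)
  have hmaxp := maxHook_eq hpart (by omega) hr
  have hmaxν := maxHook_eq (r := r) hν
    (by rw [if_neg (by omega)]; omega) (fun i hi => by
      split_ifs with h
      · exact iff_of_true (by omega) (hrm i h)
      · exact hr i hi)
  have hmaxμ := maxHook_eq (r := r) hμ (by simp) (fun i hi => by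
      split_ifs with h h'
      · have := hrm m rfl
        exact iff_of_true (by omega) (by omega)
      · exact iff_of_true (by omega) (hrm i h')
      · exact hr i hi)
  rw [if_neg (by omega)] at hmaxν
  rw [if_pos rfl] at hmaxμ
  refine ⟨hμ, hν, hmaxp, hmaxν, ?_, ?_, ?_⟩ <;> omega
end

section
/- Let A be a commutative ring that is a finitely generated ℂ-algebra, let G be a finite group acting on A by ℂ-algebra automorphisms, let A^G be the invariant subring, and let π : Spec A → Spec A^G be the morphism induced by the inclusion A^G ⊆ A. Let M be a finitely generated A-module equipped with an additive G-action satisfying g·(a m) = (g·a)(g·m) for all g ∈ G, a ∈ A, m ∈ M. Then Supp_A(M) = π^{-1}(Supp_{A^G}(M)), where M is regarded as an A^G-module by restriction of scalars. -/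
/-- The invariant subalgebra `A^G` of a group `G` acting on a commutative `ℂ`-algebra
`A` by `ℂ`-algebra automorphisms. -/
noncomputable def fixedSubalg (G : Type*) [Group G] (A : Type*) [CommRing A]
    [Algebra ℂ A] [MulSemiringAction G A] [SMulCommClass G ℂ A] : Subalgebra ℂ A :=
  ⨅ g : G, AlgHom.equalizer (MulSemiringAction.toAlgHom ℂ A g) (AlgHom.id ℂ A)

theorem mem_fixedSubalg_iff {G A : Type*} [Group G] [CommRing A] [Algebra ℂ A]
    [MulSemiringAction G A] [SMulCommClass G ℂ A] {a : A} :
    a ∈ fixedSubalg G A ↔ ∀ g : G, g • a = a := by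
  simp [fixedSubalg, Algebra.mem_iInf, AlgHom.mem_equalizer]

/-- The annihilator of a module with a semilinear group action is stable under the group. -/
theorem Module.smul_mem_annihilator_of_semilinear {G A M : Type*} [Group G] [CommRing A]
    [MulSemiringAction G A] [AddCommGroup M] [Module A M] [DistribMulAction G M]
    (hcompat : ∀ (g : G) (a : A) (m : M), g • (a • m) = (g • a) • (g • m))
    {a : A} (ha : a ∈ Module.annihilator A M) (g : G) :
    g • a ∈ Module.annihilator A M := by
  rw [Module.mem_annihilator] at ha ⊢
  intro m
  rw [← smul_inv_smul g m, ← hcompat, ha, smul_zero]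

/-- If an ideal contains the orbit of an element `a` outside a prime `p`, then it contains an
invariant element outside `p`, namely a coefficient of the characteristic polynomial of `a`. -/
theorem Ideal.exists_invariant_mem_notMem {G A : Type*} [Group G] [Finite G] [CommRing A]
    [MulSemiringAction G A] {I p : Ideal A} [p.IsPrime] {a : A}
    (haI : ∀ g : G, g • a ∈ I) (hap : a ∉ p) :
    ∃ c ∈ I, c ∉ p ∧ ∀ g : G, g • c = c := by
  cases nonempty_fintype G
  set P := MulSemiringAction.charpoly G a with hP
  have hmap : P.map (Ideal.Quotient.mk I) = Polynomial.X ^ Fintype.card G := by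
    simp [hP, MulSemiringAction.charpoly_eq, Polynomial.map_prod,
      Ideal.Quotient.eq_zero_iff_mem.mpr (haI _)]
  by_contra! hc
  have hcoeff (i : ℕ) (hi : i < P.natDegree) : P.coeff i ∈ p := by
    by_contra hip
    obtain ⟨g, hg⟩ := hc (P.coeff i) (by
      by_cases hI : Nontrivial (A ⧸ I)
      · have hdeg : P.natDegree = Fintype.card G := by
          rw [← (MulSemiringAction.monic_charpoly G a).natDegree_map (Ideal.Quotient.mk I), hmap,
            Polynomial.natDegree_X_pow]
        rw [← Ideal.Quotient.eq_zero_iff_mem, ← Polynomial.coeff_map, hmap,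
          Polynomial.coeff_X_pow, if_neg (by lia)]
      · rw [not_nontrivial_iff_subsingleton] at hI
        exact Ideal.Quotient.eq_zero_iff_mem.mp (Subsingleton.elim _ _)) hip
    exact hg (MulSemiringAction.smul_coeff_charpoly a i g)
  have heval := MulSemiringAction.eval_charpoly G a
  rw [← hP, Polynomial.eval_eq_sum_range, Finset.sum_range_succ,
    (MulSemiringAction.monic_charpoly G a).coeff_natDegree, one_mul] at heval
  refine hap (‹p.IsPrime›.mem_of_pow_mem P.natDegree ?_)
  rw [add_comm] at heval
  rw [eq_neg_of_add_eq_zero_left heval]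
  exact neg_mem (p.sum_mem fun i hi ↦ p.mul_mem_right _ (hcoeff i (Finset.mem_range.mp hi)))

/-- let `A` be a finitely generated commutative `ℂ`-algebra with an
action of a finite group `G` by `ℂ`-algebra automorphisms, `A^G` the invariant
subring and `π : Spec A → Spec A^G` the induced morphism.  For every finitely
generated `A`-module `M` with a compatible (semilinear) `G`-action one has
`Supp_A(M) = π⁻¹(Supp_{A^G}(M))`. -/
theorem statement11 (A : Type*) [CommRing A] [Algebra ℂ A] [Algebra.FiniteType ℂ A]
    (G : Type*) [Group G] [Finite G] [MulSemiringAction G A] [SMulCommClass G ℂ A]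
    (M : Type*) [AddCommGroup M] [Module A M] [Module.Finite A M]
    [DistribMulAction G M]
    (hcompat : ∀ (g : G) (a : A) (m : M), g • (a • m) = (g • a) • (g • m)) :
    Module.support A M
      = (PrimeSpectrum.comap (algebraMap ↥(fixedSubalg G A) A)) ⁻¹'
          Module.support ↥(fixedSubalg G A) M := by
  ext p
  rw [Set.mem_preimage]
  constructor
  · rw [Module.mem_support_iff', Module.mem_support_iff']
    rintro ⟨m, hm⟩
    exact ⟨m, fun r hr ↦ hm r hr⟩
  · contrapose
    rw [Module.mem_support_iff_of_finite, SetLike.not_le_iff_exists, Module.notMem_support_iff']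
    rintro ⟨a, ha, hap⟩ m
    obtain ⟨c, hc, hcp, hcG⟩ := Ideal.exists_invariant_mem_notMem
      (Module.smul_mem_annihilator_of_semilinear hcompat ha) hap
    exact ⟨⟨c, mem_fixedSubalg_iff.mpr hcG⟩, hcp, Module.mem_annihilator.mp hc m⟩
end
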